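/- Let d, K ∈ ℕ and let u : ℕ₀^d → ℝ satisfy 1 ≤ u_i ≤ (π/2)^{d/2}·(2/√π)^{|i|₀} for all i ∈ ℕ₀^d. Then: (a) for the total degree index set I_K^{TD} := {i ∈ ℕ₀^d : |i|₁ ≤ K}, every s ≥ 1, and every nonempty Δ ⊊ I_K^{TD} with |Δ| ≤ s, one has M(Δ; u, 1) := |Δ|_u + (max_{i∈I_K^{TD}∖Δ} u_i²)·max{|Δ|, 1} ≤ 2·(π/2)^d·(4/π)^{min{K,d}}·s; (b) for every s ≥ 1, every nonempty finite lower set Δ ⊆ ℕ₀^d with |Δ| ≤ s, and every finite set I_K ⊆ ℕ₀^d with Δ ⊊ I_K, one has M(Δ; u, u) = |Δ|_u + max{|Δ|_u, 1} ≤ 2·min{ 2^d·s , (π/2)^d·s^{log(1+4/π)/log 2} }. -/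

import Mathlib

open scoped BigOperators

/-- `|i|₀`: the number of nonzero entries of a multi-index `i ∈ ℕ₀^d`. -/
def zeroNorm {d : ℕ} (i : Fin d → ℕ) : ℕ := (Finset.univ.filter fun j => i j ≠ 0).card

/-- A finite set `Δ ⊆ ℕ₀^d` is lower (downwards closed). -/
def IsLowerIndexSet {d : ℕ} (Δ : Finset (Fin d → ℕ)) : Prop :=
  ∀ i ∈ Δ, ∀ i' : Fin d → ℕ, (∀ j, i' j ≤ i j) → i' ∈ Δ

/-- `a^β + (2^β - 1) b^β` is at most `(a + b)^β` when `0 ≤ b ≤ a` and `β ≥ 1`. -/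
theorem rpow_add_mul_rpow_le_add_rpow {a b c β : ℝ} (hβ : 1 ≤ β) (hc : (2 : ℝ) ^ β = 1 + c)
    (ha : 0 < a) (hb : 0 ≤ b) (hba : b ≤ a) :
    a ^ β + c * b ^ β ≤ (a + b) ^ β := by
  have hconv := convexOn_rpow hβ
  have hb' : b ∈ Set.Ici (0 : ℝ) := hb
  have hab' : a + b ∈ Set.Ici (0 : ℝ) := add_nonneg ha.le hb
  have hl : 0 ≤ (a - b) / a := div_nonneg (sub_nonneg.2 hba) ha.le
  have hr : 0 ≤ b / a := div_nonneg hb ha.le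
  have hsum : (a - b) / a + b / a = 1 := by field_simp; ring
  have h1 := hconv.2 hb' hab' hl hr hsum
  have h2 := hconv.2 hb' hab' hr hl (by rw [add_comm, hsum])
  simp only [smul_eq_mul] at h1 h2
  have e1 : (a - b) / a * b + b / a * (a + b) = 2 * b := by field_simp; ring
  have e2 : b / a * b + (a - b) / a * (a + b) = a := by field_simp; ring
  rw [e1, Real.mul_rpow zero_le_two hb, hc] at h1
  rw [e2] at h2
  have e3 : (a - b) / a * b ^ β + b / a * (a + b) ^ β
      + (b / a * b ^ β + (a - b) / a * (a + b) ^ β) = b ^ β + (a + b) ^ β := by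
    linear_combination (b ^ β + (a + b) ^ β) * hsum
  linarith

theorem zeroNorm_le {d : ℕ} (i : Fin d → ℕ) : zeroNorm i ≤ d :=
  (Finset.card_le_univ _).trans_eq (Fintype.card_fin d)

theorem zeroNorm_le_sum {d : ℕ} (i : Fin d → ℕ) : zeroNorm i ≤ ∑ j, i j := by
  rw [zeroNorm, Finset.card_filter]
  refine Finset.sum_le_sum fun j _ => ?_
  split_ifs <;> omega

theorem zeroNorm_eq_update_add_one {d : ℕ} {i : Fin d → ℕ} {j : Fin d} (hj : i j ≠ 0) :
    zeroNorm i = zeroNorm (Function.update i j 0) + 1 := by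
  have h : (Finset.univ.filter fun k => Function.update i j 0 k ≠ 0)
      = (Finset.univ.filter fun k => i k ≠ 0).erase j := by
    ext k
    by_cases hk : k = j
    · subst hk; simp
    · simp [hk]
  rw [zeroNorm, zeroNorm, h, Finset.card_erase_add_one]
  simpa using hj

theorem IsLowerIndexSet.sum_pow_zeroNorm_le {d : ℕ} {c β : ℝ} (hc0 : 0 ≤ c) (hβ : 1 ≤ β)
    (hc : (2 : ℝ) ^ β = 1 + c) (Δ : Finset (Fin d → ℕ)) (hΔ : IsLowerIndexSet Δ) :
    ∑ i ∈ Δ, c ^ zeroNorm i ≤ (Δ.card : ℝ) ^ β := by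
  induction hn : Δ.card using Nat.strong_induction_on generalizing Δ with
  | _ n ih =>
  subst hn
  by_cases h0 : ∃ i ∈ Δ, ∃ j, i j ≠ 0
  · obtain ⟨i₀, hi₀, j, hj⟩ := h0
    obtain ⟨p, hp, hmax⟩ := Finset.exists_max_image Δ (fun i => i j) ⟨i₀, hi₀⟩
    have hpj : 0 < p j := (Nat.pos_of_ne_zero hj).trans_le (hmax i₀ hi₀)
    set A := Δ.filter fun i => ¬ i j = p j with hA
    set B := Δ.filter fun i => i j = p j with hB
    set B' := B.image fun i => Function.update i j 0 with hB'
    have hinj : Set.InjOn (fun i : Fin d → ℕ => Function.update i j 0) B := by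
      intro x hx y hy hxy
      simp only [hB, Finset.coe_filter, Set.mem_ofPred_eq] at hx hy
      ext k
      by_cases hk : k = j
      · rw [hk, hx.2, hy.2]
      · simpa [hk] using congrFun hxy k
    have hcard : B'.card = B.card := Finset.card_image_of_injOn hinj
    have hAB : B.card + A.card = Δ.card := Finset.card_filter_add_card_filter_not _
    have hAlow : IsLowerIndexSet A := by
      intro i hi i' hle
      rw [hA, Finset.mem_filter] at hi ⊢
      refine ⟨hΔ i hi.1 i' hle, ?_⟩
      have h1 := hmax i hi.1
      have h2 := hle j
      have h3 := hi.2
      omega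
    have hB'low : IsLowerIndexSet B' := by
      intro i hi i' hle
      rw [hB', Finset.mem_image] at hi ⊢
      obtain ⟨q, hq, rfl⟩ := hi
      rw [hB, Finset.mem_filter] at hq
      have hi'j : i' j = 0 := by simpa using hle j
      refine ⟨Function.update i' j (p j), ?_, ?_⟩
      · rw [hB, Finset.mem_filter]
        refine ⟨hΔ q hq.1 _ fun k => ?_, by simp⟩
        by_cases hk : k = j
        · subst hk; simp [hq.2]
        · simpa [hk] using hle k
      · rw [Function.update_idem, ← hi'j, Function.update_eq_self]
    have hB'A : B' ⊆ A := by
      intro i hi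
      rw [hB', Finset.mem_image] at hi
      obtain ⟨q, hq, rfl⟩ := hi
      rw [hB, Finset.mem_filter] at hq
      rw [hA, Finset.mem_filter]
      refine ⟨hΔ q hq.1 _ fun k => ?_, by simpa using hpj.ne⟩
      by_cases hk : k = j
      · subst hk; simp
      · simp [hk]
    have hBpos : 0 < B.card := Finset.card_pos.2 ⟨p, Finset.mem_filter.2 ⟨hp, rfl⟩⟩
    have hBA : B'.card ≤ A.card := Finset.card_le_card hB'A
    have hsumB : ∑ i ∈ B, c ^ zeroNorm i = c * ∑ i ∈ B', c ^ zeroNorm i := by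
      rw [hB', Finset.sum_image hinj, Finset.mul_sum]
      refine Finset.sum_congr rfl fun i hi => ?_
      rw [hB, Finset.mem_filter] at hi
      rw [zeroNorm_eq_update_add_one (i := i) (j := j) (by omega), pow_succ, mul_comm]
    have ihA := ih A.card (by omega) A hAlow rfl
    have ihB := ih B'.card (by omega) B' hB'low rfl
    calc ∑ i ∈ Δ, c ^ zeroNorm i
        = ∑ i ∈ A, c ^ zeroNorm i + c * ∑ i ∈ B', c ^ zeroNorm i := by
          rw [← hsumB, add_comm]
          exact (Finset.sum_filter_add_sum_filter_not Δ _ _).symm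
      _ ≤ (A.card : ℝ) ^ β + c * (B'.card : ℝ) ^ β := by gcongr
      _ ≤ ((A.card : ℝ) + B'.card) ^ β :=
          rpow_add_mul_rpow_le_add_rpow hβ hc (by exact_mod_cast (by omega : 0 < A.card))
            (Nat.cast_nonneg _) (by exact_mod_cast hBA)
      _ = (Δ.card : ℝ) ^ β := by rw [← hAB, hcard]; push_cast; rw [add_comm]
  · push Not at h0
    have hsub : Δ ⊆ {0} := fun i hi => Finset.mem_singleton.2 (funext (h0 i hi))
    rcases Finset.subset_singleton_iff.1 hsub with rfl | rfl
    · simp [Real.zero_rpow (by linarith : β ≠ 0)]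
    · simp [zeroNorm]

/-- Tensor Legendre polynomials with Chebyshev sampling: if
`1 ≤ u_i ≤ (π/2)^{d/2}·(2/√π)^{|i|₀}`, then (a) for the total degree set and any nonempty
`Δ ⊊ I_K^{TD}` with `|Δ| ≤ s`, `M(Δ;u,1) ≤ 2·(π/2)^d·(4/π)^{min{K,d}}·s`; and (b) for any
nonempty finite lower `Δ` with `|Δ| ≤ s` and finite `I_K ⊋ Δ`,
`M(Δ;u,u) = |Δ|_u + max{|Δ|_u,1} ≤ 2·min{2^d·s, (π/2)^d·s^{log(1+4/π)/log 2}}`. -/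
theorem stmt10 (d K : ℕ) (u : (Fin d → ℕ) → ℝ)
    (hu1 : ∀ i, 1 ≤ u i)
    (hu2 : ∀ i, u i ≤ (Real.pi / 2) ^ ((d : ℝ) / 2) * (2 / Real.sqrt Real.pi) ^ zeroNorm i) :
    (∀ IK : Finset (Fin d → ℕ), (∀ i : Fin d → ℕ, i ∈ IK ↔ ∑ j, i j ≤ K) →
      ∀ s : ℝ, 1 ≤ s →
        ∀ Δ : Finset (Fin d → ℕ), Δ.Nonempty → (Δ.card : ℝ) ≤ s →
          ∀ hssub : Δ ⊂ IK,
            (∑ i ∈ Δ, u i ^ 2) +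
                ((IK \ Δ).sup' (Finset.sdiff_nonempty.mpr hssub.not_subset)
                    fun i => u i ^ 2) * max (Δ.card : ℝ) 1 ≤
              2 * (Real.pi / 2) ^ d * (4 / Real.pi) ^ min K d * s) ∧
    (∀ s : ℝ, 1 ≤ s →
      ∀ Δ : Finset (Fin d → ℕ), Δ.Nonempty → IsLowerIndexSet Δ → (Δ.card : ℝ) ≤ s →
        ∀ IK : Finset (Fin d → ℕ), ∀ hssub : Δ ⊂ IK,
          ((∑ i ∈ Δ, u i ^ 2) +
              ((IK \ Δ).sup' (Finset.sdiff_nonempty.mpr hssub.not_subset)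
                  fun i => u i ^ 2 / u i ^ 2) * max (∑ i ∈ Δ, u i ^ 2) 1 =
            (∑ i ∈ Δ, u i ^ 2) + max (∑ i ∈ Δ, u i ^ 2) 1) ∧
          (∑ i ∈ Δ, u i ^ 2) + max (∑ i ∈ Δ, u i ^ 2) 1 ≤
            2 * min (2 ^ d * s)
              ((Real.pi / 2) ^ d * s ^ (Real.log (1 + 4 / Real.pi) / Real.log 2))) := by
  have hπ := Real.pi_pos
  have hc1 : 1 ≤ 4 / Real.pi := by rw [le_div_iff₀ hπ]; linarith [Real.pi_le_four]
  have hP : 0 < (Real.pi / 2) ^ d := by positivity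
  have hsq : ∀ i, u i ^ 2 ≤ (Real.pi / 2) ^ d * (4 / Real.pi) ^ zeroNorm i := by
    intro i
    have h := pow_le_pow_left₀ (zero_le_one.trans (hu1 i)) (hu2 i) 2
    refine h.trans_eq ?_
    rw [mul_pow, ← Real.rpow_natCast, ← Real.rpow_mul (by positivity), pow_right_comm, div_pow,
      Real.sq_sqrt hπ.le, ← Real.rpow_natCast _ d]
    norm_num
  have hsum_le : ∀ (m : ℕ) (Δ : Finset (Fin d → ℕ)), (∀ i ∈ Δ, zeroNorm i ≤ m) →
      ∑ i ∈ Δ, u i ^ 2 ≤ Δ.card * ((Real.pi / 2) ^ d * (4 / Real.pi) ^ m) := by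
    intro m Δ h
    rw [← nsmul_eq_mul]
    refine Finset.sum_le_card_nsmul _ _ _ fun i hi => (hsq i).trans ?_
    gcongr
    exact h i hi
  constructor
  · intro IK hIK s hs Δ hne hcard hssub
    have hz : ∀ i ∈ IK, zeroNorm i ≤ min K d := fun i hi =>
      le_min ((zeroNorm_le_sum i).trans ((hIK i).1 hi)) (zeroNorm_le i)
    have h1 := hsum_le (min K d) Δ fun i hi => hz i (hssub.1 hi)
    have h2 : ((IK \ Δ).sup' (Finset.sdiff_nonempty.mpr hssub.not_subset) fun i => u i ^ 2) ≤
        (Real.pi / 2) ^ d * (4 / Real.pi) ^ min K d := by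
      refine Finset.sup'_le _ _ fun i hi => (hsq i).trans ?_
      gcongr
      exact hz i (Finset.mem_sdiff.1 hi).1
    have h3 : max (Δ.card : ℝ) 1 ≤ s := max_le hcard hs
    set C := (Real.pi / 2) ^ d * (4 / Real.pi) ^ min K d with hC
    have hC0 : 0 ≤ C := by positivity
    calc _ ≤ s * C + C * s := by
          gcongr
          exact h1.trans (by gcongr)
      _ = _ := by rw [hC]; ring
  · intro s hs Δ hne hlow hcard IK hssub
    have hone : ∀ i, u i ^ 2 / u i ^ 2 = 1 := fun i =>
      div_self (pow_ne_zero 2 (zero_lt_one.trans_le (hu1 i)).ne')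
    refine ⟨by simp only [hone, Finset.sup'_const, one_mul], ?_⟩
    have hge : 1 ≤ ∑ i ∈ Δ, u i ^ 2 := by
      obtain ⟨i, hi⟩ := hne
      exact (one_le_pow₀ (hu1 i)).trans
        (Finset.single_le_sum (f := fun i => u i ^ 2) (fun _ _ => sq_nonneg _) hi)
    rw [max_eq_left hge, ← two_mul]
    refine mul_le_mul_of_nonneg_left (le_min ?_ ?_) zero_le_two
    · have h := hsum_le d Δ fun i _ => zeroNorm_le i
      have e : Real.pi / 2 * (4 / Real.pi) = 2 := by field_simp; norm_num
      rw [← mul_pow, e, mul_comm] at h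
      exact h.trans (by gcongr)
    · have hlog2 : 0 < Real.log 2 := Real.log_pos one_lt_two
      set β := Real.log (1 + 4 / Real.pi) / Real.log 2 with hβdef
      have hβ : 1 ≤ β := by
        rw [hβdef, one_le_div hlog2]
        exact Real.log_le_log two_pos (by linarith)
      have h2β : (2 : ℝ) ^ β = 1 + 4 / Real.pi := by
        rw [Real.rpow_def_of_pos two_pos, hβdef, mul_div_cancel₀ _ hlog2.ne',
          Real.exp_log (by positivity)]
      calc ∑ i ∈ Δ, u i ^ 2 ≤ ∑ i ∈ Δ, (Real.pi / 2) ^ d * (4 / Real.pi) ^ zeroNorm i :=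
            Finset.sum_le_sum fun i _ => hsq i
        _ = (Real.pi / 2) ^ d * ∑ i ∈ Δ, (4 / Real.pi) ^ zeroNorm i := by rw [Finset.mul_sum]
        _ ≤ (Real.pi / 2) ^ d * (Δ.card : ℝ) ^ β := by
            gcongr
            exact hlow.sum_pow_zeroNorm_le (by positivity) hβ h2β Δ
        _ ≤ (Real.pi / 2) ^ d * s ^ β := by gcongr
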